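/- arXiv:2310.19314 — 6 statements merged into one kernel-verified Lean document; each statement's English description precedes it below -/
import Mathlib

section
/- In the larger number game G = (ℕ, ℕ, π), where π(s,t) = 1 if s ≥ t and π(s,t) = 0 otherwise, the minimax property fails in the strongest possible way: sup over mixed strategies p of player 1 of the inf over mixed strategies q of player 2 of π^mix(p,q) equals 0, while the inf over mixed strategies q of player 2 of the sup over mixed strategies p of player 1 of π^mix(p,q) equals 1. -/
open scoped ENNReal Classical

/-- The expected payoff to player 1 (probability that player 1 wins) when player 1
uses mixed strategy `p` and player 2 uses mixed strategy `q`, in the win-lose game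
with payoff relation `π` (`π s t` means player 1 wins). -/
noncomputable def mixedPayoff {S T : Type*} (π : S → T → Prop) (p : PMF S) (q : PMF T) : ℝ≥0∞ :=
  ∑' s, ∑' t, p s * q t * (if π s t then 1 else 0)

lemma mixedPayoff_le_one {S T : Type*} (π : S → T → Prop) (p : PMF S) (q : PMF T) :
    mixedPayoff π p q ≤ 1 := by
  calc mixedPayoff π p q ≤ ∑' s, ∑' t, p s * q t :=
        ENNReal.tsum_le_tsum fun s => ENNReal.tsum_le_tsum fun t => by split_ifs <;> simp
    _ = 1 := by simp [ENNReal.tsum_mul_left, PMF.tsum_coe]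

lemma mixedPayoff_pure_right {S T : Type*} (π : S → T → Prop) (p : PMF S) (t : T) :
    mixedPayoff π p (PMF.pure t) = ∑' s, p s * (if π s t then 1 else 0) := by
  refine tsum_congr fun s => ?_
  rw [tsum_eq_single t fun t' h => by simp [PMF.pure_apply, h]]
  simp [PMF.pure_apply]

lemma mixedPayoff_pure_left {S T : Type*} (π : S → T → Prop) (s : S) (q : PMF T) :
    mixedPayoff π (PMF.pure s) q = ∑' t, q t * (if π s t then 1 else 0) := by
  unfold mixedPayoff
  rw [tsum_eq_single s fun s' h => by simp [PMF.pure_apply, h]]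
  simp [PMF.pure_apply]

lemma mixedPayoff_le_pure_right (p : PMF ℕ) (t : ℕ) :
    mixedPayoff (fun s t => t ≤ s) p (PMF.pure t) = ∑' k, p (k + t) := by
  rw [mixedPayoff_pure_right, ← ENNReal.summable.sum_add_tsum_nat_add' (k := t),
    Finset.sum_eq_zero fun s hs => by simpa using fun h => absurd (Finset.mem_range.1 hs) h.not_gt]
  simp

lemma mixedPayoff_le_pure_left (s : ℕ) (q : PMF ℕ) :
    mixedPayoff (fun s t => t ≤ s) (PMF.pure s) q = ∑ t ∈ Finset.range (s + 1), q t := by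
  rw [mixedPayoff_pure_left, tsum_eq_sum (s := Finset.range (s + 1))]
  · refine Finset.sum_congr rfl fun t ht => ?_
    simp [Nat.lt_succ_iff.1 (Finset.mem_range.1 ht)]
  · intro t ht
    simp only [Finset.mem_range, not_lt] at ht
    simp [Nat.not_le.2 (Nat.lt_of_succ_le ht)]

/-- In the larger number game, `sup_p inf_q = 0` while `inf_q sup_p = 1`. -/
theorem lng_minimax_gap :
    (⨆ p : PMF ℕ, ⨅ q : PMF ℕ, mixedPayoff (fun s t => t ≤ s) p q) = 0 ∧
    (⨅ q : PMF ℕ, ⨆ p : PMF ℕ, mixedPayoff (fun s t => t ≤ s) p q) = 1 := by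
  refine ⟨?_, le_antisymm ?_ ?_⟩
  · refine le_antisymm (iSup_le fun p => ?_) zero_le
    refine ge_of_tendsto' (ENNReal.tendsto_sum_nat_add p p.tsum_coe_ne_top) fun t => ?_
    exact (iInf_le _ (PMF.pure t)).trans (mixedPayoff_le_pure_right p t).le
  · exact (iInf_le _ (PMF.pure 0)).trans (iSup_le fun p => mixedPayoff_le_one _ p _)
  · refine le_iInf fun q => ?_
    have h := (ENNReal.tendsto_nat_tsum q).comp (Filter.tendsto_add_atTop_nat 1)
    rw [q.tsum_coe] at h
    refine le_of_tendsto' h fun s => ?_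
    exact (mixedPayoff_le_pure_left s q).ge.trans
      (le_iSup (fun p => mixedPayoff (fun s t => t ≤ s) p q) (PMF.pure s))
end

section
/- Let G = (S, T, π) be a countable two-person win-lose game such that every set in the family B¹(G) is finite, and assume G is LNG-free. Then G satisfies the minimax property with value 0: max over mixed strategies p on S of the inf over mixed strategies q on T of π^mix(p,q) equals 0, and the inf over mixed strategies q on T of the max over mixed strategies p on S of π^mix(p,q) equals 0. -/
open scoped ENNReal Classical

/-- A game is LNG-free if no subgame of it is isomorphic to the larger number game. -/
def LNGFree {S T : Type*} (π : S → T → Prop) : Prop :=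
  ¬ ∃ (s : ℕ → S) (t : ℕ → T), Function.Injective s ∧ Function.Injective t ∧
      ∀ i j, π (s i) (t j) ↔ j ≤ i

/-- In an LNG-free game with finite rows, no infinite set of columns has all its finite subsets
contained in rows. -/
theorem LNGFree.finite_of_forall_finset_subset_row {S T : Type*} {π : S → T → Prop}
    (hfin : ∀ s, {t | π s t}.Finite) (hLNG : LNGFree π) (U : Set T)
    (hU : ∀ A : Finset T, (∀ t ∈ A, t ∈ U) → ∃ s, ∀ t ∈ A, π s t) : U.Finite := by
  by_contra hinf
  obtain ⟨f, hP, hr⟩ := exists_seq_of_forall_finset_exists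
    (fun x : S × T => x.2 ∈ U ∧ π x.1 x.2) (fun x y => π y.1 x.2 ∧ ¬ π x.1 y.2) (by
      intro F hF
      have hbig : (⋃ x ∈ F, {t | π x.1 t}).Finite :=
        F.finite_toSet.biUnion fun x _ => hfin x.1
      obtain ⟨t, htU, ht⟩ := (Set.Infinite.sdiff hinf hbig).nonempty
      obtain ⟨s, hs⟩ := hU (insert t (F.image Prod.snd)) (by
        intro u hu
        rcases Finset.mem_insert.1 hu with rfl | hu
        · exact htU
        · obtain ⟨x, hx, rfl⟩ := Finset.mem_image.1 hu
          exact (hF x hx).1)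
      refine ⟨(s, t), ⟨htU, hs t (Finset.mem_insert_self _ _)⟩, fun x hx => ⟨?_, fun h => ?_⟩⟩
      · exact hs _ (Finset.mem_insert_of_mem (Finset.mem_image_of_mem _ hx))
      · exact ht (Set.mem_biUnion hx h))
  have key : ∀ i j, π (f i).1 (f j).2 ↔ j ≤ i := by
    intro i j
    rcases lt_trichotomy i j with h | rfl | h
    · exact iff_of_false (hr i j h).2 (not_le.2 h)
    · exact iff_of_true (hP i).2 le_rfl
    · exact iff_of_true (hr j i h).1 h.le
  refine hLNG ⟨fun i => (f i).1, fun j => (f j).2, ?_, ?_, key⟩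
  · intro i j h
    have h : (f i).1 = (f j).1 := h
    exact le_antisymm ((key j i).1 (h ▸ (key i i).2 le_rfl))
      ((key i j).1 (h ▸ (key j j).2 le_rfl))
  · intro i j h
    have h : (f i).2 = (f j).2 := h
    exact le_antisymm ((key j i).1 (h ▸ (key j j).2 le_rfl))
      ((key i j).1 (h ▸ (key i i).2 le_rfl))

/-- `A'` adds one element to `A` and is still contained in some row. -/
def RowExtension {S T : Type*} (π : S → T → Prop) (A' A : Finset T) : Prop :=
  ∃ t ∉ A, A' = insert t A ∧ ∃ s, ∀ x ∈ A', π s x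

theorem LNGFree.wellFounded_rowExtension {S T : Type*} {π : S → T → Prop}
    (hfin : ∀ s, {t | π s t}.Finite) (hLNG : LNGFree π) : WellFounded (RowExtension π) := by
  rw [wellFounded_iff_isEmpty_descending_chain]
  refine ⟨fun ⟨f, hf⟩ => ?_⟩
  have hss : StrictMono f := strictMono_nat_of_lt_succ fun n => by
    obtain ⟨t, ht, h, -⟩ := hf n
    rw [h]
    exact Finset.ssubset_insert ht
  have hU : (⋃ n, (f n : Set T)).Finite := by
    refine hLNG.finite_of_forall_finset_subset_row hfin _ fun A hA => ?_
    choose! g hg using fun t ht => Set.mem_iUnion.1 (hA t ht)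
    obtain ⟨-, -, -, s, hs⟩ := hf (A.sup g)
    refine ⟨s, fun t ht => hs t ?_⟩
    exact hss.monotone ((Finset.le_sup ht).trans (Nat.le_succ _)) (hg t ht)
  refine Set.infinite_range_of_injective hss.injective ?_
  refine (hU.toFinset.powerset.finite_toSet).subset ?_
  rintro _ ⟨n, rfl⟩
  simp only [Finset.coe_powerset, Set.mem_preimage, Set.mem_powerset_iff, Set.Finite.coe_toFinset]
  exact Set.subset_iUnion (fun n => (f n : Set T)) n

/-- The probability that player 1 wins with the pure strategy `s` against a finitely supported
strategy of player 2, extended linearly to finitely supported weights. -/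
noncomputable def rowWeight {S T : Type*} (π : S → T → Prop) (s : S) : (T →₀ ℝ) →ₗ[ℝ] ℝ :=
  Finsupp.linearCombination ℝ fun t => if π s t then 1 else 0

theorem rowWeight_eq_zero {S T : Type*} {π : S → T → Prop} {s : S} {q : T →₀ ℝ}
    (h : ∀ t ∈ q.support, ¬ π s t) : rowWeight π s q = 0 := by
  rw [rowWeight, Finsupp.linearCombination_apply]
  exact Finset.sum_eq_zero fun t ht => by simp [h t ht]

/-- A convex set of finitely supported weights with elements avoiding every finite set. -/
structure IsAvoiding {T : Type*} (C : Set (T →₀ ℝ)) : Prop where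
  convex : Convex ℝ C
  avoids : ∀ E : Finset T, ∃ q ∈ C, Disjoint q.support E

theorem IsAvoiding.inter_disjoint {T : Type*} {C : Set (T →₀ ℝ)} (hC : IsAvoiding C)
    (E : Finset T) : IsAvoiding (C ∩ {q | Disjoint q.support E}) where
  convex := by
    rintro x ⟨hx, hxE⟩ y ⟨hy, hyE⟩ a b ha hb hab
    refine ⟨hC.convex hx hy ha hb hab, ?_⟩
    refine Finset.disjoint_of_subset_left Finsupp.support_add ?_
    exact Finset.disjoint_union_left.2
      ⟨Finset.disjoint_of_subset_left Finsupp.support_smul hxE,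
        Finset.disjoint_of_subset_left Finsupp.support_smul hyE⟩
  avoids F := by
    obtain ⟨q, hq, hd⟩ := hC.avoids (E ∪ F)
    rw [Finset.disjoint_union_right] at hd
    exact ⟨q, ⟨hq, hd.1⟩, hd.2⟩

/-- Player 2 can make every row containing `A` light inside every avoiding convex set. -/
def IsLight {S T : Type*} (π : S → T → Prop) (A : Finset T) : Prop :=
  ∀ C : Set (T →₀ ℝ), IsAvoiding C → (∀ q ∈ C, ∀ s, rowWeight π s q ≤ 1) → ∀ ε > 0,
    ∃ q ∈ C, ∀ s, (∀ x ∈ A, π s x) → rowWeight π s q ≤ ε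

theorem convex_rowWeight_le {S T : Type*} (π : S → T → Prop) (A : Finset T) (ε : ℝ) :
    Convex ℝ {q : T →₀ ℝ | ∀ s, (∀ x ∈ A, π s x) → rowWeight π s q ≤ ε} := by
  intro x hx y hy a b ha hb hab s hs
  rw [map_add, map_smul, map_smul, smul_eq_mul, smul_eq_mul]
  calc a * rowWeight π s x + b * rowWeight π s y ≤ a * ε + b * ε :=
        add_le_add (mul_le_mul_of_nonneg_left (hx s hs) ha)
          (mul_le_mul_of_nonneg_left (hy s hs) hb)
    _ = ε := by rw [← add_mul, hab, one_mul]

theorem IsLight.isAvoiding_inter {S T : Type*} {π : S → T → Prop} {A : Finset T}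
    (hA : IsLight π A) {C : Set (T →₀ ℝ)} (hC : IsAvoiding C)
    (h1 : ∀ q ∈ C, ∀ s, rowWeight π s q ≤ 1) {ε : ℝ} (hε : 0 < ε) :
    IsAvoiding (C ∩ {q | ∀ s, (∀ x ∈ A, π s x) → rowWeight π s q ≤ ε}) where
  convex := hC.convex.inter (convex_rowWeight_le π A ε)
  avoids E := by
    obtain ⟨q, hq, h⟩ := hA _ (hC.inter_disjoint E) (fun q hq => h1 q hq.1) ε hε
    exact ⟨q, ⟨hq.1, h⟩, hq.2⟩

theorem exists_light_of_forall_isLight {S T : Type*} {π : S → T → Prop} {A : Finset T}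
    (F : Finset T) (hF : ∀ t ∈ F, IsLight π (insert t A)) {ε : ℝ} (hε : 0 < ε) :
    ∀ C : Set (T →₀ ℝ), IsAvoiding C → (∀ q ∈ C, ∀ s, rowWeight π s q ≤ 1) →
      ∃ q ∈ C, ∀ s, (∀ x ∈ A, π s x) → (∃ t ∈ F, π s t) → rowWeight π s q ≤ ε := by
  induction F using Finset.induction_on with
  | empty =>
    intro C hC _
    obtain ⟨q, hq, -⟩ := hC.avoids ∅
    exact ⟨q, hq, by simp⟩
  | insert t F _ ih =>
    intro C hC h1
    obtain ⟨q, hq, h⟩ := ih (fun u hu => hF u (Finset.mem_insert_of_mem hu)) _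
      ((hF t (Finset.mem_insert_self _ _)).isAvoiding_inter hC h1 hε) (fun q hq => h1 q hq.1)
    refine ⟨q, hq.1, fun s hs ⟨u, hu, hsu⟩ => ?_⟩
    rcases Finset.mem_insert.1 hu with rfl | hu
    · refine hq.2 s fun x hx => ?_
      rcases Finset.mem_insert.1 hx with rfl | hx
      · exact hsu
      · exact hs x hx
    · exact h s hs ⟨u, hu, hsu⟩

theorem isLight_of_forall_insert {S T : Type*} {π : S → T → Prop} {A : Finset T}
    (hA : ∀ t ∉ A, IsLight π (insert t A)) : IsLight π A := by
  intro C hC h1 ε hε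
  have hD := hC.inter_disjoint A
  set D := C ∩ {q | Disjoint q.support A}
  have key : ∀ n : ℕ, ∃ q ∈ D, ∀ s, (∀ x ∈ A, π s x) →
      rowWeight π s q ≤ 1 / ((n : ℝ) + 1) + ε / 2 := by
    intro n
    induction n with
    | zero =>
      obtain ⟨q, hq, -⟩ := hD.avoids ∅
      refine ⟨q, hq, fun s _ => (h1 q hq.1 s).trans ?_⟩
      norm_num
      positivity
    | succ n ih =>
      obtain ⟨q, hq, hqs⟩ := ih
      obtain ⟨r, hr, hrs⟩ := exists_light_of_forall_isLight q.support
        (fun t ht => hA t (Finset.disjoint_left.1 hq.2 ht)) (half_pos hε) D hD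
        (fun q hq => h1 q hq.1)
      have hn : (0 : ℝ) < (n : ℝ) + 1 := by positivity
      have hn' : (0 : ℝ) < (n : ℝ) + 1 + 1 := by positivity
      refine ⟨(((n : ℝ) + 1) / (n + 1 + 1)) • q + ((1 : ℝ) / (n + 1 + 1)) • r,
        hD.convex hq hr (by positivity) (by positivity) (by field_simp), fun s hs => ?_⟩
      rw [map_add, map_smul, map_smul, smul_eq_mul, smul_eq_mul]
      push_cast
      by_cases hm : ∃ t ∈ q.support, π s t
      · calc _ ≤ (((n : ℝ) + 1) / (n + 1 + 1)) * (1 / ((n : ℝ) + 1) + ε / 2)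
              + ((1 : ℝ) / (n + 1 + 1)) * (ε / 2) := by
              gcongr
              · exact hqs s hs
              · exact hrs s hs hm
          _ = _ := by field_simp; ring
      · rw [rowWeight_eq_zero (fun t ht h => hm ⟨t, ht, h⟩), mul_zero, zero_add]
        calc _ ≤ (1 : ℝ) / (n + 1 + 1) * 1 := by
              gcongr
              exact h1 r hr.1 s
          _ ≤ _ := by linarith
  obtain ⟨n, hn⟩ := exists_nat_one_div_lt (half_pos hε)
  obtain ⟨q, hq, h⟩ := key n
  exact ⟨q, hq.1, fun s hs => (h s hs).trans (by linarith)⟩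

theorem LNGFree.isLight {S T : Type*} {π : S → T → Prop}
    (hfin : ∀ s, {t | π s t}.Finite) (hLNG : LNGFree π) (A : Finset T) : IsLight π A := by
  induction A using (hLNG.wellFounded_rowExtension hfin).induction with
  | _ A ih =>
    refine isLight_of_forall_insert fun t ht => ?_
    by_cases h : ∃ s, ∀ x ∈ insert t A, π s x
    · exact ih _ ⟨t, ht, rfl, h⟩
    · intro C hC _ ε _
      obtain ⟨q, hq, -⟩ := hC.avoids ∅
      exact ⟨q, hq, fun s hs => (h ⟨s, hs⟩).elim⟩

/-- The probability that player 1 wins with the pure strategy `s` against `q`. -/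
noncomputable def rowProb {S T : Type*} (π : S → T → Prop) (q : PMF T) (s : S) : ℝ≥0∞ :=
  ∑' t, q t * (if π s t then 1 else 0)

theorem mixedPayoff_eq_tsum_rowProb {S T : Type*} (π : S → T → Prop) (p : PMF S) (q : PMF T) :
    mixedPayoff π p q = ∑' s, p s * rowProb π q s := by
  simp only [mixedPayoff, rowProb, ← ENNReal.tsum_mul_left, mul_assoc]

theorem mixedPayoff_pure {S T : Type*} (π : S → T → Prop) (s : S) (q : PMF T) :
    mixedPayoff π (PMF.pure s) q = rowProb π q s := by
  rw [mixedPayoff_eq_tsum_rowProb, tsum_eq_single s]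
  · simp
  · intro s' hs'
    simp [PMF.pure_apply, hs']

theorem mixedPayoff_le_of_forall_rowProb_le {S T : Type*} {π : S → T → Prop} (p : PMF S)
    {q : PMF T} {M : ℝ≥0∞} (hM : ∀ s, rowProb π q s ≤ M) : mixedPayoff π p q ≤ M := by
  rw [mixedPayoff_eq_tsum_rowProb]
  calc ∑' s, p s * rowProb π q s ≤ ∑' s, p s * M :=
        ENNReal.tsum_le_tsum fun s => mul_le_mul_right (hM s) _
    _ = M := by rw [ENNReal.tsum_mul_right, p.tsum_coe, one_mul]

theorem LNGFree.exists_pmf_forall_rowProb_le {S T : Type*} [Infinite T] {π : S → T → Prop}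
    (hfin : ∀ s, {t | π s t}.Finite) (hLNG : LNGFree π) {ε : ℝ} (hε : 0 < ε) :
    ∃ q : PMF T, ∀ s, rowProb π q s ≤ ENNReal.ofReal ε := by
  let tot : (T →₀ ℝ) →ₗ[ℝ] ℝ := Finsupp.linearCombination ℝ fun _ => 1
  have htot : ∀ q, tot q = ∑ t ∈ q.support, q t := fun q => by
    simp [tot, Finsupp.linearCombination_apply, Finsupp.sum]
  have hrow : ∀ s q, rowWeight π s q = ∑ t ∈ q.support, q t * (if π s t then 1 else 0) :=
    fun s q => by simp [rowWeight, Finsupp.linearCombination_apply, Finsupp.sum]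
  obtain ⟨q, ⟨h0, h1⟩, hq⟩ := hLNG.isLight hfin ∅ {q | (∀ t, 0 ≤ q t) ∧ tot q = 1}
    ⟨by
      rintro x ⟨hx, hx'⟩ y ⟨hy, hy'⟩ a b ha hb hab
      refine ⟨fun t => ?_, by simp [hx', hy', hab]⟩
      have := hx t
      have := hy t
      simp only [Finsupp.add_apply, Finsupp.smul_apply, smul_eq_mul]
      positivity, fun E => by
      obtain ⟨t, ht⟩ := Infinite.exists_notMem_finset E
      refine ⟨Finsupp.single t 1, ⟨fun u => ?_, by simp [tot]⟩, ?_⟩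
      · rw [Finsupp.single_apply]
        split_ifs <;> norm_num
      · exact Finset.disjoint_of_subset_left Finsupp.support_single_subset
          (Finset.disjoint_singleton_left.2 ht)⟩
    (by
      rintro q ⟨h0, h1⟩ s
      rw [← h1, hrow, htot]
      refine Finset.sum_le_sum fun t _ => mul_le_of_le_one_right (h0 t) ?_
      split_ifs <;> norm_num) ε hε
  refine ⟨PMF.ofFinset (fun t => ENNReal.ofReal (q t)) q.support ?_ ?_, fun s => ?_⟩
  · rw [← ENNReal.ofReal_sum_of_nonneg fun t _ => h0 t, ← htot, h1, ENNReal.ofReal_one]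
  · intro t ht
    simp [Finsupp.notMem_support_iff.1 ht]
  · rw [rowProb, tsum_eq_sum (s := q.support)]
    · refine le_trans (le_of_eq ?_) (ENNReal.ofReal_le_ofReal (hq s (by simp)))
      rw [hrow, ENNReal.ofReal_sum_of_nonneg (s := q.support)
        (f := fun t => q t * (if π s t then 1 else 0)) fun t _ => by
          have := h0 t
          positivity]
      refine Finset.sum_congr rfl fun t _ => ?_
      split_ifs <;> simp
    · intro t ht
      simp [Finsupp.notMem_support_iff.1 ht]

theorem LNGFree.exists_forall_rowProb_le {S T : Type*} [Nonempty S] {π : S → T → Prop}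
    (hfin : ∀ s, {t | π s t}.Finite) (hLNG : LNGFree π) (q : PMF T) :
    ∃ s, ∀ s', rowProb π q s' ≤ rowProb π q s := by
  have hne : (Set.range (rowProb π q)).Nonempty := Set.range_nonempty _
  obtain ⟨u, -, hu, hmem⟩ := exists_seq_tendsto_sSup hne (OrderTop.bddAbove _)
  choose σ hσ using hmem
  let ℱ : Filter ℕ := Filter.hyperfilter ℕ
  let B : Set T := {t | ∀ᶠ n in ℱ, π (σ n) t}
  have hsub : ∀ A : Finset T, (∀ t ∈ A, t ∈ B) → ∃ n, ∀ t ∈ A, π (σ n) t := fun A hA =>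
    ((Filter.eventually_all_finset A).2 hA).exists
  have hB : B.Finite := hLNG.finite_of_forall_finset_subset_row hfin B fun A hA =>
    (hsub A hA).imp' σ fun _ h => h
  obtain ⟨n, hn⟩ := hsub hB.toFinset fun t ht => hB.mem_toFinset.1 ht
  have hle : ∀ s t, q t * (if π s t then 1 else 0) ≤ q t := fun s t => by split_ifs <;> simp
  have hlim : Filter.Tendsto (fun k => rowProb π q (σ k)) ℱ
      (nhds (∑' t, q t * (if t ∈ B then 1 else 0))) := by
    have hreal : Filter.Tendsto
        (fun k => ∑' t, (q t * (if π (σ k) t then 1 else 0)).toReal) ℱ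
        (nhds (∑' t, (q t * (if t ∈ B then 1 else 0)).toReal)) := by
      refine tendsto_tsum_of_dominated_convergence (bound := fun t => (q t).toReal)
        (ENNReal.summable_toReal q.tsum_coe_ne_top) (fun t => ?_)
        (Filter.Eventually.of_forall fun k t => ?_)
      · refine tendsto_const_nhds.congr' ?_
        by_cases ht : t ∈ B
        · filter_upwards [ht] with k hk
          simp [ht, hk]
        · filter_upwards [Ultrafilter.eventually_not.2 ht] with k hk
          simp [ht, hk]
      · rw [Real.norm_of_nonneg ENNReal.toReal_nonneg]
        exact ENNReal.toReal_mono (q.apply_ne_top t) (hle _ _)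
    have hconv : ∀ f : T → ℝ≥0∞, (∀ t, f t ≤ q t) →
        ∑' t, f t = ENNReal.ofReal (∑' t, (f t).toReal) := fun f hf => by
      rw [← ENNReal.tsum_toReal_eq fun t => ne_top_of_le_ne_top (q.apply_ne_top t) (hf t),
        ENNReal.ofReal_toReal]
      exact ne_top_of_le_ne_top q.tsum_coe_ne_top (ENNReal.tsum_le_tsum hf)
    simp only [rowProb]
    rw [hconv _ fun t => by split_ifs <;> simp]
    simp_rw [hconv _ (hle _)]
    exact ENNReal.tendsto_ofReal hreal
  have hlim' : Filter.Tendsto (fun k => rowProb π q (σ k)) ℱ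
      (nhds (sSup (Set.range (rowProb π q)))) := by
    simp_rw [hσ]
    exact hu.mono_left Nat.hyperfilter_le_atTop
  refine ⟨σ n, fun s' => (le_sSup (Set.mem_range_self s')).trans ?_⟩
  rw [tendsto_nhds_unique hlim' hlim]
  refine ENNReal.tsum_le_tsum fun t => mul_le_mul_right ?_ _
  by_cases ht : t ∈ B
  · simp [ht, hn t (hB.mem_toFinset.2 ht)]
  · simp [ht]

/-- Corollary 2.10: a countable LNG-free game all of whose rows are finite satisfies
the minimax property with value `0`, in the form `max_p inf_q = 0 = inf_q max_p`
(the maxima over `p` being attained). -/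
theorem minimax_value_zero_of_finite_rows_LNGFree
    {S T : Type*} [Countable S] [Infinite S] [Countable T] [Infinite T]
    (π : S → T → Prop) (hfin : ∀ s, {t | π s t}.Finite) (hLNG : LNGFree π) :
    (⨆ p : PMF S, ⨅ q : PMF T, mixedPayoff π p q) = 0 ∧
    (⨅ q : PMF T, ⨆ p : PMF S, mixedPayoff π p q) = 0 ∧
    (∀ q : PMF T, ∃ p : PMF S, mixedPayoff π p q = ⨆ p' : PMF S, mixedPayoff π p' q) := by
  have hinf : (⨅ q : PMF T, ⨆ p : PMF S, mixedPayoff π p q) = 0 := by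
    refine le_antisymm (ENNReal.le_of_forall_pos_le_add fun ε hε _ => ?_) zero_le
    obtain ⟨q, hq⟩ := hLNG.exists_pmf_forall_rowProb_le hfin (ε := ε) hε
    rw [zero_add]
    refine (iInf_le _ q).trans (iSup_le fun p => mixedPayoff_le_of_forall_rowProb_le p fun s => ?_)
    simpa using hq s
  refine ⟨le_antisymm ((iSup_iInf_le_iInf_iSup _).trans hinf.le) zero_le, hinf, fun q => ?_⟩
  obtain ⟨s, hs⟩ := hLNG.exists_forall_rowProb_le hfin q
  refine ⟨PMF.pure s, le_antisymm (le_iSup (fun p => mixedPayoff π p q) _) (iSup_le fun p => ?_)⟩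
  rw [mixedPayoff_pure]
  exact mixedPayoff_le_of_forall_rowProb_le p hs
end

section
/- Let G = (S, T, π) be a countable two-person win-lose game such that the family B²_down(G) is ascending-union closed. Then G satisfies the minimax property in the form: sup over mixed strategies p on S of the min over mixed strategies q on T of π^mix(p,q) equals the min over mixed strategies q on T of the sup over mixed strategies p on S of π^mix(p,q); in particular the relevant minima over q are attained. -/
open scoped ENNReal Classical

/-- A family of sets is ascending-union closed if the union of every countable
strictly ascending chain of members of the family is again a member. -/
def AscendingUnionClosed {X : Type*} (F : Set (Set X)) : Prop :=
  ∀ A : ℕ → Set X, (∀ i, A i ∈ F) → (∀ i, A i ⊂ A (i + 1)) → (⋃ i, A i) ∈ F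

/-- `B²_down(G)`: the downward closure of the family of (complemented) columns of the
game: the sets of player 1's strategies beaten by some fixed strategy of player 2. -/
def B2down {S T : Type*} (π : S → T → Prop) : Set (Set S) :=
  {A | ∃ t, A ⊆ {s | ¬ π s t}}

open MeasureTheory Filter Topology

theorem AscendingUnionClosed.iUnion_mem_of_monotone {X : Type*} {F : Set (Set X)}
    (hF : AscendingUnionClosed F) {A : ℕ → Set X} (hA : ∀ i, A i ∈ F) (hmono : Monotone A) :
    (⋃ i, A i) ∈ F := by
  by_cases hstab : ∃ N, ∀ n, A n ⊆ A N
  · obtain ⟨N, hN⟩ := hstab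
    have : (⋃ i, A i) = A N := (Set.iUnion_subset hN).antisymm (Set.subset_iUnion A N)
    exact this ▸ hA N
  · push Not at hstab
    choose f hf using hstab
    have hlt : ∀ N, A N ⊂ A (f N) := fun N ↦ by
      rcases le_total (f N) N with h | h
      · exact absurd (hmono h) (hf N)
      · exact ⟨hmono h, hf N⟩
    have hstep : ∀ i, A (f^[i] 0) ⊂ A (f^[i + 1] 0) := fun i ↦ by
      rw [Function.iterate_succ_apply']
      exact hlt _
    have hle : ∀ i, i ≤ f^[i] 0 := fun i ↦ by
      induction i with
      | zero => exact Nat.zero_le _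
      | succ k ih =>
        rw [Function.iterate_succ_apply']
        refine Nat.succ_le_of_lt (ih.trans_lt ?_)
        by_contra hcon
        exact hf _ (hmono (not_lt.mp hcon))
    have heq : (⋃ i, A i) = ⋃ i, A (f^[i] 0) :=
      (Set.iUnion_subset fun i ↦ (hmono (hle i)).trans
        (Set.subset_iUnion (fun i ↦ A (f^[i] 0)) i)).antisymm
        (Set.iUnion_subset fun i ↦ Set.subset_iUnion A _)
    rw [heq]
    exact hF _ (fun i ↦ hA _) hstep

section Game

variable {S T : Type*} (π : S → T → Prop)

/-- The indicator functions of the members of `B2down π`, as a subset of the Cantor space. -/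
def beatenIndicators : Set (S → Bool) :=
  {x | ∃ t, ∀ s, x s = true → ¬ π s t}

/-- The indicator function of the set of strategies of player 1 beaten by `t`. -/
noncomputable def columnIndicator (t : T) : beatenIndicators π :=
  ⟨fun s ↦ decide (¬ π s t), t, fun _ hs ↦ of_decide_eq_true hs⟩

theorem columnIndicator_eq_false_iff (s : S) (t : T) :
    (columnIndicator π t).1 s = false ↔ π s t := by
  simp [columnIndicator]

theorem mixedPayoff_eq_tsum_left (p : PMF S) (q : PMF T) :
    mixedPayoff π p q = ∑' s, p s * ∑' t, q t * (if π s t then 1 else 0) := by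
  simp only [mixedPayoff, ← ENNReal.tsum_mul_left, mul_assoc]

theorem mixedPayoff_eq_tsum_right (p : PMF S) (q : PMF T) :
    mixedPayoff π p q = ∑' t, q t * ∑' s, p s * (if π s t then 1 else 0) := by
  rw [mixedPayoff, ENNReal.tsum_comm]
  simp only [← ENNReal.tsum_mul_left]
  exact tsum_congr fun t ↦ tsum_congr fun s ↦ by ring

theorem mixedPayoff_pure_s6 (p : PMF S) (t : T) :
    mixedPayoff π p (PMF.pure t) = ∑' s, p s * (if π s t then 1 else 0) := by
  rw [mixedPayoff_eq_tsum_right, tsum_eq_single t fun t' ht' ↦ by simp [PMF.pure_apply, ht']]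
  simp [PMF.pure_apply]

variable {π}

theorem mixedPayoff_le_of_forall {q : PMF T} {c : ℝ≥0∞}
    (hq : ∀ s, ∑' t, q t * (if π s t then 1 else 0) ≤ c) (p : PMF S) :
    mixedPayoff π p q ≤ c := by
  rw [mixedPayoff_eq_tsum_left]
  calc _ ≤ ∑' s, p s * c := ENNReal.tsum_le_tsum fun s ↦ by gcongr; exact hq s
    _ = c := by rw [ENNReal.tsum_mul_right, p.tsum_coe, one_mul]

theorem le_mixedPayoff_of_forall {p : PMF S} {c : ℝ≥0∞}
    (hp : ∀ t, c ≤ ∑' s, p s * (if π s t then 1 else 0)) (q : PMF T) :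
    c ≤ mixedPayoff π p q := by
  rw [mixedPayoff_eq_tsum_right]
  calc c = ∑' t, q t * c := by rw [ENNReal.tsum_mul_right, q.tsum_coe, one_mul]
    _ ≤ _ := ENNReal.tsum_le_tsum fun t ↦ by gcongr; exact hp t

theorem isClosed_beatenIndicators [Countable S] (h : AscendingUnionClosed (B2down π)) :
    IsClosed (beatenIndicators π) := by
  refine isClosed_of_closure_subset fun x hx ↦ ?_
  obtain ⟨y, hy, hlim⟩ := mem_closure_iff_seq_limit.mp hx
  have hev : ∀ s, ∃ n, ∀ m ≥ n, y m s = x s := fun s ↦ by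
    have := (tendsto_pi_nhds.mp hlim) s
    rw [nhds_discrete, tendsto_pure] at this
    exact eventually_atTop.mp this
  obtain ⟨t, ht⟩ := h.iUnion_mem_of_monotone (A := fun n ↦ {s | ∀ m ≥ n, y m s = true})
    (fun n ↦ (hy n).imp fun t ht s hs ↦ ht s (hs n le_rfl))
    (fun n k hnk s hs m hm ↦ hs m (hnk.trans hm))
  refine ⟨t, fun s hs ↦ ht (Set.mem_iUnion.mpr ?_)⟩
  obtain ⟨n, hn⟩ := hev s
  exact ⟨n, fun m hm ↦ (hn m hm).trans hs⟩

theorem measurableSet_eval_eq_false (s : S) :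
    MeasurableSet {x : beatenIndicators π | x.1 s = false} :=
  measurableSet_eq_fun ((measurable_pi_apply s).comp measurable_subtype_coe) measurable_const

/-- A measurable choice of a reply of player 2 beating a given member of `B2down π`. -/
theorem exists_measurable_reply [Countable S] [Countable T] [Nonempty T]
    [MeasurableSpace T] : ∃ τ : beatenIndicators π → T, Measurable τ ∧
      ∀ x s, π s (τ x) → x.1 s = false := by
  obtain ⟨e, he⟩ := exists_surjective_nat T
  have hex : ∀ x : beatenIndicators π, ∃ n, ∀ s, x.1 s = true → ¬ π s (e n) := fun x ↦ by
    obtain ⟨t, ht⟩ := x.2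
    obtain ⟨n, rfl⟩ := he t
    exact ⟨n, ht⟩
  refine ⟨fun x ↦ e (Nat.find (hex x)), (measurable_of_countable e).comp
    (measurable_find hex fun n ↦ ?_), fun x s hs ↦ ?_⟩
  · have : {x : beatenIndicators π | ∀ s, x.1 s = true → ¬ π s (e n)} =
        ⋂ s, ⋂ _ : π s (e n), {x | x.1 s = false} := by
      ext x
      simp only [Set.mem_ofPred_eq, Set.mem_iInter]
      exact forall_congr' fun s ↦ by cases x.1 s <;> simp
    rw [this]
    exact .iInter fun s ↦ .iInter fun _ ↦ measurableSet_eval_eq_false s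
  · have := Nat.find_spec (hex x) s
    cases hx : x.1 s
    · rfl
    · exact absurd hs (this hx)

theorem exists_pmf_forall_le_measure [Countable S] [Countable T] [Nonempty T]
    (μ : Measure (beatenIndicators π)) [IsProbabilityMeasure μ] :
    ∃ q : PMF T, ∀ s, ∑' t, q t * (if π s t then 1 else 0) ≤ μ {x | x.1 s = false} := by
  let : MeasurableSpace T := ⊤
  obtain ⟨τ, hτ, hreply⟩ := exists_measurable_reply (π := π)
  have := Measure.isProbabilityMeasure_map (μ := μ) hτ.aemeasurable
  refine ⟨(μ.map τ).toPMF, fun s ↦ ?_⟩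
  have hset : MeasurableSet {t | π s t} := trivial
  calc ∑' t, (μ.map τ).toPMF t * (if π s t then 1 else 0)
      = (μ.map τ).toPMF.toMeasure {t | π s t} := by
        rw [PMF.toMeasure_apply _ hset]
        exact tsum_congr fun t ↦ by simp [Set.indicator_apply]
    _ = μ (τ ⁻¹' {t | π s t}) := by
        rw [Measure.toPMF_toMeasure, Measure.map_apply hτ hset]
    _ ≤ μ {x | x.1 s = false} := measure_mono fun x hx ↦ hreply x s hx

/-- The vector of winning probabilities of player 1 against a random member of `B2down π`. -/
noncomputable def winVector (μ : ProbabilityMeasure (beatenIndicators π)) (s : S) : ℝ :=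
  (μ : Measure (beatenIndicators π)).real {x | x.1 s = false}

theorem continuous_winVector [Countable S] :
    Continuous (winVector : ProbabilityMeasure (beatenIndicators π) → S → ℝ) := by
  refine continuous_pi fun s ↦ continuous_iff_continuousAt.mpr fun μ ↦ ?_
  have hclopen : IsClopen {x : beatenIndicators π | x.1 s = false} :=
    (isClopen_discrete {false}).preimage ((continuous_apply s).comp continuous_subtype_val)
  have := ProbabilityMeasure.tendsto_measure_of_null_frontier_of_tendsto' (μ := μ)
    (L := 𝓝 μ) (μs := id) tendsto_id (E := {x | x.1 s = false}) (by simp [hclopen.frontier_eq])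
  exact (ENNReal.tendsto_toReal (measure_ne_top _ _)).comp this

theorem convex_range_winVector :
    Convex ℝ (Set.range (winVector : ProbabilityMeasure (beatenIndicators π) → S → ℝ)) := by
  rintro _ ⟨μ, rfl⟩ _ ⟨ν, rfl⟩ a b ha hb hab
  have hprob : IsProbabilityMeasure
      (ENNReal.ofReal a • (μ : Measure (beatenIndicators π)) +
        ENNReal.ofReal b • (ν : Measure (beatenIndicators π))) :=
    ⟨by simp [← ENNReal.ofReal_add ha hb, hab]⟩
  refine ⟨⟨_, hprob⟩, funext fun s ↦ ?_⟩
  simp only [winVector, ProbabilityMeasure.coe_mk, Pi.add_apply, Pi.smul_apply, smul_eq_mul]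
  have hfin (r : ℝ) (ρ : ProbabilityMeasure (beatenIndicators π)) :
      (ENNReal.ofReal r • (ρ : Measure (beatenIndicators π))) {x | x.1 s = false} ≠ ∞ :=
    ENNReal.mul_ne_top ENNReal.ofReal_ne_top (measure_ne_top _ _)
  rw [measureReal_add_apply (hfin a μ) (hfin b ν)]
  simp [measureReal_ennreal_smul_apply, ha, hb]

theorem winVector_dirac (t : T) (s : S) :
    winVector ⟨Measure.dirac (columnIndicator π t), inferInstance⟩ s =
      if π s t then 1 else 0 := by
  simp only [winVector, ProbabilityMeasure.coe_mk, Measure.real]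
  rw [Measure.dirac_apply' _ (measurableSet_eval_eq_false s)]
  by_cases hst : π s t <;> simp [columnIndicator_eq_false_iff, hst]

theorem hasSum_mul_map_single (f : StrongDual ℝ (S → ℝ)) (x : S → ℝ) :
    HasSum (fun s ↦ x s * f (Pi.single s 1)) (f x) := by
  have hx : HasSum (fun s ↦ x s • (Pi.single s 1 : S → ℝ)) x := by
    refine Pi.hasSum.mpr fun i ↦ ?_
    convert hasSum_single i fun j hj ↦ ?_ using 1
    · simp
    · simp [hj.symm]
  simpa using f.hasSum hx

/-- A vector of nonnegative weights that guarantees more than `v` against every column yields a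
mixed strategy that does so. -/
theorem lt_iSup_iInf_of_hasSum {c : S → ℝ} {C v w : ℝ} (hc : ∀ s, 0 ≤ c s) (hC : HasSum c C)
    (hCpos : 0 < C) (hv : 0 ≤ v) (hvw : v * C < w)
    (hw : ∀ t, w ≤ ∑' s, (if π s t then 1 else 0) * c s) :
    ENNReal.ofReal v < ⨆ p : PMF S, ⨅ q : PMF T, mixedPayoff π p q := by
  have hsum : HasSum (fun s ↦ c s / C) 1 := by
    simpa [div_self hCpos.ne'] using hC.div_const C
  have hnn : ∀ s, 0 ≤ c s / C := fun s ↦ div_nonneg (hc s) hCpos.le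
  let p : PMF S := ⟨fun s ↦ ENNReal.ofReal (c s / C), by
    rw [ENNReal.summable.hasSum_iff, ← ENNReal.ofReal_tsum_of_nonneg hnn hsum.summable,
      hsum.tsum_eq, ENNReal.ofReal_one]⟩
  have hvw' : v < w / C := (lt_div_iff₀ hCpos).mpr hvw
  refine ((ENNReal.ofReal_lt_ofReal_iff (hv.trans_lt hvw')).mpr hvw').trans_le
    (le_iSup_of_le p (le_iInf (le_mixedPayoff_of_forall fun t ↦ ?_)))
  have hnn' : ∀ s, 0 ≤ (if π s t then 1 else 0) * (c s / C) := fun s ↦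
    mul_nonneg (by split_ifs <;> norm_num) (hnn s)
  have hsummable : Summable fun s ↦ (if π s t then 1 else 0) * (c s / C) :=
    hsum.summable.of_nonneg_of_le hnn' fun s ↦ by
      split_ifs
      · simp
      · simpa using hnn s
  calc ENNReal.ofReal (w / C)
      ≤ ENNReal.ofReal (∑' s, (if π s t then 1 else 0) * (c s / C)) := by
        refine ENNReal.ofReal_le_ofReal ?_
        simp only [← mul_div_assoc, tsum_div_const]
        exact div_le_div_of_nonneg_right (hw t) hCpos.le
    _ = ∑' s, ENNReal.ofReal ((if π s t then 1 else 0) * (c s / C)) :=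
        ENNReal.ofReal_tsum_of_nonneg hnn' hsummable
    _ = ∑' s, p s * (if π s t then 1 else 0) := tsum_congr fun s ↦ by
        change _ = ENNReal.ofReal (c s / C) * _
        split_ifs <;> simp

theorem exists_winVector_le [Countable S] [Nonempty T]
    (h : AscendingUnionClosed (B2down π)) {v : ℝ} (hv : 0 ≤ v)
    (hval : (⨆ p : PMF S, ⨅ q : PMF T, mixedPayoff π p q) ≤ ENNReal.ofReal v) :
    ∃ μ : ProbabilityMeasure (beatenIndicators π), ∀ s, winVector μ s ≤ v := by
  by_contra! hcon
  have : CompactSpace (beatenIndicators π) :=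
    isCompact_iff_compactSpace.mp (isClosed_beatenIndicators h).isCompact
  obtain ⟨f, u, w, hfL, huw, hfK⟩ := geometric_hahn_banach_closed_compact
    (convex_Iic (fun _ : S ↦ v)) isClosed_Iic convex_range_winVector
    (isCompact_range (continuous_winVector (π := π))) (by
      rw [Set.disjoint_left]
      rintro _ hx ⟨μ, rfl⟩
      obtain ⟨s, hs⟩ := hcon μ
      exact hs.not_ge (hx s))
  have hc : ∀ s, 0 ≤ f (Pi.single s 1) := fun s ↦ by
    by_contra! hneg
    have hbound : ∀ r : ℝ, 0 ≤ r → f (fun _ ↦ v) - r * f (Pi.single s 1) < u := fun r hr ↦ by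
      have := hfL ((fun _ ↦ v) - r • Pi.single s 1) fun i ↦ by
        by_cases hi : i = s <;> simp [hi, hr]
      simpa using this
    have hu := hbound 0 le_rfl
    have := hbound ((u - f fun _ ↦ v) / -f (Pi.single s 1))
      (div_nonneg (by linarith) (by linarith))
    rw [div_mul_eq_mul_div, mul_div_assoc, div_neg, div_self hneg.ne] at this
    linarith
  have hC : HasSum (fun s ↦ f (Pi.single s 1)) (f fun _ ↦ 1) := by
    simpa using hasSum_mul_map_single f fun _ ↦ 1
  have hvC : v * f (fun _ ↦ 1) < w := by
    have hconst : (fun _ : S ↦ v) = v • fun _ ↦ (1 : ℝ) := by ext; simp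
    have := hfL _ (Set.self_mem_Iic (a := fun _ : S ↦ v))
    rw [hconst, map_smul, smul_eq_mul] at this
    exact this.trans huw
  have hw : ∀ t, w ≤ ∑' s, (if π s t then 1 else 0) * f (Pi.single s 1) := fun t ↦ by
    have := hfK _ ⟨⟨Measure.dirac (columnIndicator π t), inferInstance⟩, rfl⟩
    rw [← (hasSum_mul_map_single f _).tsum_eq] at this
    simpa only [winVector_dirac] using this.le
  have hCpos : 0 < f fun _ ↦ 1 := by
    refine (hC.nonneg hc).lt_of_ne fun h0 ↦ ?_
    have hzero := (hasSum_zero_iff_of_nonneg hc).mp (h0 ▸ hC)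
    have := hw (Classical.arbitrary T)
    simp only [fun s ↦ congrFun hzero s, Pi.zero_apply, mul_zero, tsum_zero] at this
    rw [← h0, mul_zero] at hvC
    linarith
  exact (lt_iSup_iInf_of_hasSum hc hC hCpos hv hvC hw).not_ge hval

/-- Player 2 has a mixed strategy that guarantees the lower value of the game. -/
theorem exists_pmf_forall_mixedPayoff_le [Countable S] [Countable T] [Nonempty T]
    (h : AscendingUnionClosed (B2down π)) :
    ∃ q : PMF T, ∀ p : PMF S, mixedPayoff π p q ≤
      ⨆ p : PMF S, ⨅ q : PMF T, mixedPayoff π p q := by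
  set V := ⨆ p : PMF S, ⨅ q : PMF T, mixedPayoff π p q with hV
  have hV1 : V ≤ 1 := iSup_le fun p ↦
    iInf_le_of_le (PMF.pure (Classical.arbitrary T)) <| mixedPayoff_le_of_forall
      (fun s ↦ (ENNReal.tsum_le_tsum fun t ↦ mul_le_of_le_one_right' (by split_ifs <;> simp)).trans
        (PMF.tsum_coe _).le) p
  have hVtop : V ≠ ∞ := (hV1.trans_lt ENNReal.one_lt_top).ne
  obtain ⟨μ, hμ⟩ := exists_winVector_le h ENNReal.toReal_nonneg (ENNReal.ofReal_toReal hVtop).ge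
  obtain ⟨q, hq⟩ := exists_pmf_forall_le_measure (μ : Measure (beatenIndicators π))
  exact ⟨q, mixedPayoff_le_of_forall fun s ↦ (hq s).trans
    ((ENNReal.toReal_le_toReal (measure_ne_top _ _) hVtop).mp (hμ s))⟩

/-- Player 2 has a pure best reply to every mixed strategy of player 1. -/
theorem exists_pure_forall_mixedPayoff_le [Countable S] [Nonempty T]
    (h : AscendingUnionClosed (B2down π)) (p : PMF S) :
    ∃ t : T, ∀ q : PMF T, mixedPayoff π p (PMF.pure t) ≤ mixedPayoff π p q := by
  have hlsc : LowerSemicontinuous fun x : S → Bool ↦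
      ∑' s, p s * (if x s = false then 1 else 0) :=
    lowerSemicontinuous_tsum fun s ↦ Continuous.lowerSemicontinuous <|
      (continuous_of_discreteTopology (f := fun b : Bool ↦ p s * (if b = false then 1 else 0))).comp
        (continuous_apply s)
  obtain ⟨x, ⟨t, ht⟩, hmin⟩ := (hlsc.lowerSemicontinuousOn _).exists_isMinOn
    ⟨_, (columnIndicator π (Classical.arbitrary T)).2⟩ (isClosed_beatenIndicators h).isCompact
  refine ⟨t, le_mixedPayoff_of_forall fun t' ↦ ?_⟩
  rw [mixedPayoff_pure_s6]
  calc ∑' s, p s * (if π s t then 1 else 0)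
      ≤ ∑' s, p s * (if x s = false then 1 else 0) := ENNReal.tsum_le_tsum fun s ↦ by
        cases hx : x s
        · gcongr
          split_ifs <;> simp_all
        · simp [ht s hx]
    _ ≤ ∑' s, p s * (if (columnIndicator π t').1 s = false then 1 else 0) :=
        hmin (columnIndicator π t').2
    _ = ∑' s, p s * (if π s t' then 1 else 0) := by
        simp only [columnIndicator_eq_false_iff]

end Game

/-- Theorem 2.11: in a countable game whose family `B²_down(G)` is ascending-union
closed, `sup_p min_q = min_q sup_p`, with the minima over `q` attained. -/
theorem minimax_of_ascendingUnionClosed_B2down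
    {S T : Type*} [Countable S] [Infinite S] [Countable T] [Infinite T]
    (π : S → T → Prop) (h : AscendingUnionClosed (B2down π)) :
    (⨆ p : PMF S, ⨅ q : PMF T, mixedPayoff π p q)
        = (⨅ q : PMF T, ⨆ p : PMF S, mixedPayoff π p q) ∧
    (∃ q : PMF T, (⨆ p : PMF S, mixedPayoff π p q)
        = ⨅ q' : PMF T, ⨆ p : PMF S, mixedPayoff π p q') ∧
    (∀ p : PMF S, ∃ q : PMF T, mixedPayoff π p q = ⨅ q' : PMF T, mixedPayoff π p q') := by
  obtain ⟨q, hq⟩ := exists_pmf_forall_mixedPayoff_le h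
  have hmaxmin : (⨆ p : PMF S, ⨅ q : PMF T, mixedPayoff π p q)
      ≤ ⨅ q : PMF T, ⨆ p : PMF S, mixedPayoff π p q := iSup_iInf_le_iInf_iSup _
  refine ⟨hmaxmin.antisymm (iInf_le_of_le q (iSup_le hq)),
    ⟨q, ((iSup_le hq).trans hmaxmin).antisymm (iInf_le _ q)⟩, fun p ↦ ?_⟩
  obtain ⟨t, ht⟩ := exists_pure_forall_mixedPayoff_le h p
  exact ⟨PMF.pure t, (le_iInf ht).antisymm (iInf_le _ _)⟩
end

section
/- Let G = (S, T, π) be a countable LNG-free two-person win-lose game. Identify each s ∈ S with its row (π(s,t))_{t∈T} ∈ {0,1}^T, and let cl(B¹(G)) be the closure of the set of rows in {0,1}^T with the product topology. Then for every ε > 0 and every z = (z_t)_{t∈T} ∈ cl(B¹(G)) there exists a finitely supported mixed strategy p on S such that for every t ∈ T with z_t = 1 one has π^mix(p, t) ≥ 1 − ε. -/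
open scoped ENNReal Classical

/-- Player 1's winning probability when playing mixed strategy `p` against the pure
strategy `t` of player 2. -/
noncomputable def purePayoff {S T : Type*} (π : S → T → Prop) (p : PMF S) (t : T) : ℝ≥0∞ :=
  ∑' s, p s * (if π s t then 1 else 0)

open Filter Topology
open scoped BoundedContinuousFunction Pointwise

/-- If every finite convex combination of the indicators of the sets `E s` reaches the value `r`
somewhere, then some finitely additive set function is bounded below on all `E s`. -/
theorem exists_finitelyAdditive_of_convexCombination {S T : Type*} (E : S → Set T) {r : ℝ}
    (hr : 0 < r)
    (h : ∀ w : S →₀ ℝ, (∀ s, 0 ≤ w s) → (w.sum fun _ a => a) = 1 →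
      ∃ t, r ≤ w.sum fun s a => a * (E s).indicator 1 t) :
    ∃ m : Set T → ℝ, Monotone m ∧ m ∅ = 0 ∧
      (∀ A B, m (A ∪ B) + m (A ∩ B) = m A + m B) ∧ ∃ u > 0, ∀ s, u ≤ m (E s) := by
  let _ : TopologicalSpace T := ⊥
  have : DiscreteTopology T := ⟨rfl⟩
  let χ : Set T → (T →ᵇ ℝ) := fun A =>
    BoundedContinuousFunction.ofNormedAddCommGroupDiscrete (A.indicator 1) 1 fun t => by
      by_cases ht : t ∈ A <;> simp [ht]
  have χ_apply : ∀ A t, χ A t = A.indicator 1 t := fun _ _ => rfl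
  let P : Set (T →ᵇ ℝ) := {g | ∀ t, g t ≤ 0}
  let D : Set (S →₀ ℝ) := {w | (∀ s, 0 ≤ w s) ∧ (w.sum fun _ a => a) = 1}
  let L := Finsupp.linearCombination ℝ fun s => χ (E s)
  have L_apply : ∀ w t, L w t = w.sum fun s a => a * (E s).indicator 1 t := by
    intro w t
    simp only [L, Finsupp.linearCombination_apply, Finsupp.sum,
      BoundedContinuousFunction.coe_sum, Finset.sum_apply, BoundedContinuousFunction.coe_smul,
      smul_eq_mul, χ_apply]
  have hP : Convex ℝ P := by
    intro f hf g hg a b ha hb _ t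
    have h1 := mul_nonneg ha (neg_nonneg.2 (hf t))
    have h2 := mul_nonneg hb (neg_nonneg.2 (hg t))
    simp only [BoundedContinuousFunction.coe_add, BoundedContinuousFunction.coe_smul,
      Pi.add_apply, smul_eq_mul]
    linarith
  have hD : Convex ℝ D := by
    intro v hv w hw a b ha hb hab
    refine ⟨fun s => ?_, ?_⟩
    · have := mul_nonneg ha (hv.1 s)
      have := mul_nonneg hb (hw.1 s)
      simp only [Finsupp.add_apply, Finsupp.smul_apply, smul_eq_mul]
      linarith
    · rw [Finsupp.sum_add_index' (fun _ => rfl) (fun _ _ _ => rfl),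
        Finsupp.sum_smul_index (fun _ => rfl), Finsupp.sum_smul_index (fun _ => rfl),
        ← Finsupp.mul_sum, ← Finsupp.mul_sum, hv.2, hw.2, mul_one, mul_one, hab]
  have hdisj : Disjoint (Metric.ball (0 : T →ᵇ ℝ) r + P) (L '' D) := by
    rw [Set.disjoint_left]
    rintro _ ⟨b, hb, g, hg, rfl⟩ ⟨w, hw, hwL⟩
    obtain ⟨t, ht⟩ := h w hw.1 hw.2
    rw [← L_apply, hwL] at ht
    have h1 := (le_abs_self _).trans (b.norm_coe_le_norm t)
    have h2 : ‖b‖ < r := by simpa using hb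
    have h3 : g t ≤ 0 := hg t
    simp only [BoundedContinuousFunction.coe_add, Pi.add_apply] at ht
    linarith
  obtain ⟨Λ, u, hlt, hle⟩ := geometric_hahn_banach_open
    ((convex_ball (0 : T →ᵇ ℝ) r).add hP) Metric.isOpen_ball.add_right
    (hD.linear_image L) hdisj
  have hmemP : ∀ g ∈ P, Λ g < u := fun g hg =>
    hlt g ⟨0, by simpa using hr, g, hg, zero_add g⟩
  have hu : 0 < u := by simpa using hmemP 0 fun t => le_rfl
  have hneg : ∀ g ∈ P, Λ g ≤ 0 := by
    intro g hg
    by_contra! hpos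
    have h1 := hmemP ((u / Λ g) • g) fun t => by
      simpa using mul_nonpos_of_nonneg_of_nonpos (div_pos hu hpos).le (hg t)
    rw [map_smul, smul_eq_mul, div_mul_cancel₀ _ hpos.ne'] at h1
    exact h1.false
  refine ⟨fun A => Λ (χ A), fun A B hAB => ?_, ?_, fun A B => ?_, u, hu, fun s => ?_⟩
  · have h1 := hneg (χ A - χ B) fun t => sub_nonpos.2
      (Set.indicator_le_indicator_of_subset hAB (fun _ => zero_le_one) t)
    rw [map_sub] at h1
    exact sub_nonpos.1 h1
  · have : χ ∅ = 0 := by ext t; simp [χ_apply]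
    simp [this]
  · simp only [← map_add]
    congr 1
    ext t
    simp only [BoundedContinuousFunction.coe_add]
    exact congrFun (Set.indicator_union_add_inter (1 : T → ℝ) A B) t
  · refine hle _ ⟨Finsupp.single s 1, ⟨fun s' => ?_, ?_⟩, ?_⟩
    · by_cases hs : s = s' <;> simp [hs]
    · simp
    · simp [L]

section

variable {S T : Type*} (W : Ultrafilter S) (m : Set T → ℝ) (E : S → Set T)

/-- The sets meeting almost every `E s` in an arbitrarily small set. -/
def AsymptoticallyNull (A : Set T) : Prop :=
  ∀ η > 0, ∀ᶠ s in W, m (A ∩ E s) < η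

variable {W m E}

theorem AsymptoticallyNull.union
    (hm : Monotone m) (hm0 : m ∅ = 0) (hadd : ∀ A B, m (A ∪ B) + m (A ∩ B) = m A + m B)
    {A B : Set T} (hA : AsymptoticallyNull W m E A) (hB : AsymptoticallyNull W m E B) :
    AsymptoticallyNull W m E (A ∪ B) := by
  intro η hη
  filter_upwards [hA (η / 2) (half_pos hη), hB (η / 2) (half_pos hη)] with s h1 h2
  have h3 := hadd (A ∩ E s) (B ∩ E s)
  have h4 : 0 ≤ m (A ∩ E s ∩ (B ∩ E s)) := hm0 ▸ hm (Set.empty_subset _)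
  rw [Set.union_inter_distrib_right]
  linarith

theorem asymptoticallyNull_empty (hm0 : m ∅ = 0) : AsymptoticallyNull W m E ∅ := by
  intro η hη
  simp [hm0, hη]

theorem exists_inter_not_asymptoticallyNull
    (hm : Monotone m) (hm0 : m ∅ = 0) (hadd : ∀ A B, m (A ∪ B) + m (A ∩ B) = m A + m B)
    {B : Set T} (hB : ¬ AsymptoticallyNull W m E B) {V : Set S} (hV : ∀ᶠ s in W, s ∈ V) :
    ∃ s ∈ V, ¬ AsymptoticallyNull W m E (B ∩ E s) := by
  by_contra! hnull
  obtain ⟨δ, hδ, hBδ⟩ : ∃ δ > 0, ∀ᶠ s in W, δ ≤ m (B ∩ E s) := by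
    unfold AsymptoticallyNull at hB
    push Not at hB
    obtain ⟨δ, hδ, h⟩ := hB
    exact ⟨δ, hδ, h⟩
  have key : ∀ k : ℕ, ∃ C ⊆ B, AsymptoticallyNull W m E C ∧ k * (δ / 2) ≤ m C := by
    intro k
    induction k with
    | zero => exact ⟨∅, Set.empty_subset _, asymptoticallyNull_empty hm0, by simp [hm0]⟩
    | succ k ih =>
      obtain ⟨C, hCB, hC, hmC⟩ := ih
      obtain ⟨s, hs, hBs, hCs⟩ := (hV.and (hBδ.and (hC (δ / 2) (half_pos hδ)))).exists
      refine ⟨C ∪ B ∩ E s, Set.union_subset hCB Set.inter_subset_left,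
        hC.union hm hm0 hadd (hnull s hs), ?_⟩
      have h1 := hadd C (B ∩ E s)
      have h2 : m (C ∩ (B ∩ E s)) ≤ m (C ∩ E s) :=
        hm (Set.inter_subset_inter_right _ Set.inter_subset_right)
      push_cast
      linarith
  obtain ⟨k, hk⟩ := exists_nat_gt (m B / (δ / 2))
  obtain ⟨C, hCB, -, hmC⟩ := key k
  rw [div_lt_iff₀ (half_pos hδ)] at hk
  exact (hk.trans_le (hmC.trans (hm hCB))).false

end

/-- Rows converging to `1` on `A` along an ultrafilter yield the larger number game if `A` is not
asymptotically null for the sets where the rows vanish. -/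
theorem not_lngFree_of_not_asymptoticallyNull {S T : Type*} {π : S → T → Prop}
    {W : Ultrafilter S} {A : Set T} (hW : ∀ t ∈ A, ∀ᶠ s in W, π s t) {m : Set T → ℝ}
    (hm : Monotone m) (hm0 : m ∅ = 0) (hadd : ∀ A B, m (A ∪ B) + m (A ∩ B) = m A + m B)
    (hA : ¬ AsymptoticallyNull W m (fun s => {t | t ∈ A ∧ ¬ π s t}) A) : ¬ LNGFree π := by
  set E : S → Set T := fun s => {t | t ∈ A ∧ ¬ π s t}
  let X := {x : Set T × Set S // x.1 ⊆ A ∧ ¬ AsymptoticallyNull W m E x.1 ∧ ∀ᶠ s in W, s ∈ x.2}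
  have step : ∀ x : X, ∃ (t : T) (s : S) (y : X), t ∈ x.1.1 ∧ s ∈ y.1.2 ∧
      y.1.1 = x.1.1 ∩ E s ∧ y.1.2 = x.1.2 ∩ {s | π s t} := by
    rintro ⟨⟨B, H⟩, hBA, hB, hH⟩
    have hne : B.Nonempty := by
      rw [Set.nonempty_iff_ne_empty]
      rintro rfl
      exact hB (asymptoticallyNull_empty hm0)
    obtain ⟨t, ht⟩ := hne
    have hV : ∀ᶠ s in W, s ∈ H ∩ {s | π s t} := hH.and (hW t (hBA ht))
    obtain ⟨s, hs, hBs⟩ := exists_inter_not_asymptoticallyNull hm hm0 hadd hB hV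
    exact ⟨t, s, ⟨(B ∩ E s, H ∩ {s | π s t}), Set.inter_subset_left.trans hBA, hBs, hV⟩,
      ht, hs, rfl, rfl⟩
  choose t s next ht hs hB hH using step
  let x : ℕ → X := fun n => next^[n] ⟨(A, Set.univ), subset_rfl, hA, by simp⟩
  have hx : ∀ n, x (n + 1) = next (x n) := fun n => Function.iterate_succ_apply' _ _ _
  have antiB : Antitone fun n => (x n).1.1 := antitone_nat_of_succ_le fun n => by
    rw [hx, hB]; exact Set.inter_subset_left
  have antiH : Antitone fun n => (x n).1.2 := antitone_nat_of_succ_le fun n => by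
    rw [hx, hH]; exact Set.inter_subset_left
  have hiff : ∀ i j, π (s (x i)) (t (x j)) ↔ j ≤ i := by
    intro i j
    refine ⟨fun h => ?_, fun h => ?_⟩
    · by_contra! hij
      have h1 := antiB (Nat.succ_le_of_lt hij) (ht (x j))
      simp only [Nat.succ_eq_add_one, hx, hB] at h1
      exact h1.2.2 h
    · have h1 : s (x i) ∈ (x (i + 1)).1.2 := by rw [hx]; exact hs _
      have h2 := antiH (Nat.succ_le_succ h) h1
      simp only [Nat.succ_eq_add_one, hx, hH] at h2
      exact h2.2
  refine not_not.2 ⟨fun n => s (x n), fun n => t (x n), fun i j hij => ?_, fun i j hij => ?_, hiff⟩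
  · simp only at hij
    exact le_antisymm ((hiff j i).1 (hij ▸ (hiff i i).2 le_rfl))
      ((hiff i j).1 (hij ▸ (hiff j j).2 le_rfl))
  · simp only at hij
    exact le_antisymm ((hiff j i).1 (hij ▸ (hiff j j).2 le_rfl))
      ((hiff i j).1 (hij ▸ (hiff i i).2 le_rfl))

/-- A finitely supported probability weight as a mixed strategy. -/
theorem exists_pmf_of_finsupp {S : Type*} (w : S →₀ ℝ) (hw : ∀ s, 0 ≤ w s)
    (hw1 : (w.sum fun _ a => a) = 1) :
    ∃ p : PMF S, p.support.Finite ∧ ∀ {T : Type*} (π : S → T → Prop) (t : T),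
      purePayoff π p t = ENNReal.ofReal (w.sum fun s a => a * if π s t then 1 else 0) := by
  have hzero : ∀ s ∉ w.support, ENNReal.ofReal (w s) = 0 := fun s hs => by
    simp [Finsupp.notMem_support_iff.1 hs]
  refine ⟨PMF.ofFinset (fun s => ENNReal.ofReal (w s)) w.support ?_ hzero, ?_, ?_⟩
  · rw [← ENNReal.ofReal_sum_of_nonneg fun s _ => hw s]
    exact (congrArg ENNReal.ofReal hw1).trans ENNReal.ofReal_one
  · refine w.support.finite_toSet.subset fun s hs => ?_
    by_contra hs'
    exact ((PMF.mem_support_iff _ _).1 hs) (hzero s hs')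
  · intro T π t
    rw [purePayoff, tsum_eq_sum (s := w.support) fun s hs => by simp [hzero s hs]]
    unfold Finsupp.sum
    rw [ENNReal.ofReal_sum_of_nonneg fun s _ => mul_nonneg (hw s) (by split_ifs <;> simp)]
    refine Finset.sum_congr rfl fun s _ => ?_
    by_cases h : π s t <;> simp [h]

/-- Step 1 of the proof of Theorem 3.1: in a countable LNG-free game, for every
`ε > 0` and every point `z` of the closure (in the product topology of `{0,1}^T`) of
the set of rows of the game, there is a finitely supported mixed strategy `p` of
player 1 winning with probability at least `1 - ε` against every `t` with `z t = 1`. -/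
theorem closure_row_approximable
    {S T : Type*} [Countable S] [Infinite S] [Countable T] [Infinite T]
    (π : S → T → Prop) (hLNG : LNGFree π) (ε : ℝ≥0∞) (hε : 0 < ε)
    (z : T → Bool) (hz : z ∈ closure (Set.range fun (s : S) (t : T) => decide (π s t))) :
    ∃ p : PMF S, p.support.Finite ∧
      ∀ t : T, z t = true → 1 - ε ≤ purePayoff π p t := by
  obtain ⟨r, hr, hrε⟩ : ∃ r : ℝ, 0 < r ∧ ENNReal.ofReal r ≤ ε := by
    obtain ⟨q, hq, hqε⟩ := ENNReal.lt_iff_exists_nnreal_btwn.1 hε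
    exact ⟨q, by exact_mod_cast hq, by simpa using hqε.le⟩
  by_contra! hfail
  let E : S → Set T := fun s => {t | t ∈ {t | z t = true} ∧ ¬ π s t}
  have hE : ∀ w : S →₀ ℝ, (∀ s, 0 ≤ w s) → (w.sum fun _ a => a) = 1 →
      ∃ t, r ≤ w.sum fun s a => a * (E s).indicator 1 t := by
    intro w hw hw1
    obtain ⟨p, hp, hpay⟩ := exists_pmf_of_finsupp w hw hw1
    obtain ⟨t, hzt, ht⟩ := hfail p hp
    refine ⟨t, ?_⟩
    have hsum : (w.sum fun s a => a * (E s).indicator 1 t) +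
        (w.sum fun s a => a * if π s t then 1 else 0) = 1 := by
      rw [← Finsupp.sum_add]
      refine Eq.trans ?_ hw1
      refine Finset.sum_congr rfl fun s _ => ?_
      by_cases h : π s t <;> simp [E, h, hzt]
    by_contra! hlt
    have h1 : 1 - ε ≤ ENNReal.ofReal (1 - r) := by
      rw [ENNReal.ofReal_sub _ hr.le, ENNReal.ofReal_one]
      exact tsub_le_tsub_left hrε 1
    refine (h1.trans_lt' ht).not_ge ?_
    rw [hpay]
    exact ENNReal.ofReal_le_ofReal (by linarith)
  obtain ⟨m, hm, hm0, hadd, u, hu, huE⟩ := exists_finitelyAdditive_of_convexCombination E hr hE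
  have hne : NeBot (comap (fun (s : S) (t : T) => decide (π s t)) (𝓝 z)) := by
    rw [comap_neBot_iff_frequently]
    exact mem_closure_iff_frequently.1 hz
  let W := Ultrafilter.of (comap (fun (s : S) (t : T) => decide (π s t)) (𝓝 z))
  have hW : ∀ t ∈ {t | z t = true}, ∀ᶠ s in W, π s t := by
    intro t ht
    refine Eventually.filter_mono (Ultrafilter.of_le _) ?_
    have h1 : ∀ᶠ y in 𝓝 z, y t = true :=
      (continuous_apply t).continuousAt.eventually_mem ((isOpen_discrete {true}).mem_nhds ht)
    exact (tendsto_comap.eventually h1).mono fun s hs => of_decide_eq_true hs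
  refine not_lngFree_of_not_asymptoticallyNull hW hm hm0 hadd (fun hnull => ?_) hLNG
  obtain ⟨s, hs⟩ := (hnull u hu).exists
  rw [Set.inter_eq_self_of_subset_right (fun _ h => h.1)] at hs
  exact (huE s).not_gt hs
end

section
/- Let F be a family of finite subsets of ℕ whose union is all of ℕ, and assume F is convergence enforcing. Then there exists a finite constant C (depending only on F) such that for every sequence (a_i)_{i∈ℕ} of nonnegative real numbers: if ∑_{i∈A} a_i ≤ 1 for all A ∈ F, then the series ∑_{i∈ℕ} a_i converges and ∑_{i∈ℕ} a_i ≤ C. -/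
/-- Proposition 4.2: if a family `F` of finite subsets of `ℕ` covering all of `ℕ` is
convergence enforcing (every nonnegative sequence whose partial sums over members of
`F` are all at most `1` is summable), then there is a uniform finite bound `C` on the
sums of all such sequences. -/
theorem exists_uniform_bound_of_convergenceEnforcing
    (F : Set (Set ℕ)) (hfin : ∀ A, ∀ _ : A ∈ F, A.Finite) (hcover : ⋃₀ F = Set.univ)
    (hce : ∀ a : ℕ → ℝ, (∀ i, 0 ≤ a i) →
      (∀ A, ∀ hA : A ∈ F, ∑ i ∈ (hfin A hA).toFinset, a i ≤ 1) → Summable a) :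
    ∃ C : ℝ, ∀ a : ℕ → ℝ, (∀ i, 0 ≤ a i) →
      (∀ A, ∀ hA : A ∈ F, ∑ i ∈ (hfin A hA).toFinset, a i ≤ 1) →
      Summable a ∧ ∑' i, a i ≤ C := by
  by_contra! hunbdd
  choose a ha hA hlarge using fun k : ℕ => hunbdd (4 ^ k)
  have hle_one : ∀ k i, a k i ≤ 1 := by
    intro k i
    obtain ⟨A, hAF, hi⟩ : i ∈ ⋃₀ F := hcover ▸ Set.mem_univ i
    exact (Finset.single_le_sum (f := a k) (fun j _ => ha k j)
      ((hfin A hAF).mem_toFinset.2 hi)).trans (hA k A hAF)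
  have hgeom : HasSum (fun k : ℕ => (1 / 2 : ℝ) / 2 ^ k) 1 := by
    simpa using hasSum_geometric_two' 1
  have hsumm : ∀ i, Summable fun k : ℕ => (1 / 2 : ℝ) / 2 ^ k * a k i := fun i =>
    Summable.of_nonneg_of_le (fun k => mul_nonneg (by positivity) (ha k i))
      (fun k => mul_le_of_le_one_right (by positivity) (hle_one k i)) hgeom.summable
  have hmix : Summable fun i => ∑' k : ℕ, (1 / 2 : ℝ) / 2 ^ k * a k i := by
    refine hce _ (fun i => tsum_nonneg fun k => mul_nonneg (by positivity) (ha k i)) ?_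
    intro A hAF
    rw [← Summable.tsum_finsetSum fun i _ => hsumm i]
    refine le_of_le_of_eq ?_ hgeom.tsum_eq
    refine Summable.tsum_le_tsum (fun k => ?_) (summable_sum fun i _ => hsumm i) hgeom.summable
    rw [← Finset.mul_sum]
    exact mul_le_of_le_one_right (by positivity) (hA k A hAF)
  have hbound : ∀ k : ℕ, (1 / 2 : ℝ) * 2 ^ k ≤
      ∑' i, ∑' k : ℕ, (1 / 2 : ℝ) / 2 ^ k * a k i := by
    intro k
    have hk : Summable (a k) := hce _ (ha k) (hA k)
    calc (1 / 2 : ℝ) * 2 ^ k = (1 / 2) / 2 ^ k * 4 ^ k := by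
          rw [show (4 : ℝ) = 2 * 2 by norm_num, mul_pow]
          field_simp
      _ ≤ (1 / 2) / 2 ^ k * ∑' i, a k i := by
          gcongr
          exact (hlarge k hk).le
      _ = ∑' i, (1 / 2) / 2 ^ k * a k i := tsum_mul_left.symm
      _ ≤ _ := (hk.mul_left _).tsum_le_tsum
          (fun i => (hsumm i).le_tsum k fun j _ => mul_nonneg (by positivity) (ha j i)) hmix
  obtain ⟨k, hk⟩ := pow_unbounded_of_one_lt
    (2 * ∑' i, ∑' k : ℕ, (1 / 2 : ℝ) / 2 ^ k * a k i) one_lt_two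
  linarith [hbound k]
end

section
/- Let F be a family of finite subsets of ℕ that is downward closed (A ⊆ B and B ∈ F imply A ∈ F) and convergence enforcing. Then F contains an infinite strictly ascending chain: there exist sets A₁ ⊂ A₂ ⊂ ⋯ ⊂ A_i ⊂ ⋯ all belonging to F. -/
/-- Pták's combinatorial lemma for the links of finitely many sets: if proper extension inside
`G` is well-founded, then some finitely supported probability vector, supported arbitrarily far
out, gives mass at most `ε` to every `B` with `A ∪ B ∈ G` for some `A ∈ S`. -/
theorem exists_small_probability_of_wellFounded (G : Set (Finset ℕ))
    (hdc : ∀ A B : Finset ℕ, A ⊆ B → B ∈ G → A ∈ G)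
    (hwf : WellFounded fun B A : Finset ℕ => A ⊂ B ∧ B ∈ G)
    (S : Finset (Finset ℕ)) (N : ℕ) {ε : ℝ} (hε : 0 < ε) :
    ∃ x : ℕ →₀ ℝ, (∀ i, 0 ≤ x i) ∧ (∀ i ∈ x.support, N ≤ i) ∧ x.degree = 1 ∧
      ∀ A ∈ S, ∀ B, A ∪ B ∈ G → ∑ i ∈ B, x i ≤ ε := by
  classical
  have : IsWellFounded (Finset ℕ) fun B A => A ⊂ B ∧ B ∈ G := ⟨hwf⟩
  let rank := IsWellFounded.rank fun B A : Finset ℕ => A ⊂ B ∧ B ∈ G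
  suffices h : ∀ α : Ordinal, ∀ (S : Finset (Finset ℕ)) (N : ℕ) (ε : ℝ), 0 < ε →
      (∀ A ∈ S, rank A < α) →
      ∃ x : ℕ →₀ ℝ, (∀ i, 0 ≤ x i) ∧ (∀ i ∈ x.support, N ≤ i) ∧ x.degree = 1 ∧
        ∀ A ∈ S, ∀ B, A ∪ B ∈ G → ∑ i ∈ B, x i ≤ ε by
    refine h (Order.succ (S.sup rank)) S N ε hε fun A hA => ?_
    exact Order.lt_succ_of_le (Finset.le_sup (f := rank) hA)
  intro α
  induction α using WellFoundedLT.induction with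
  | ind α ih =>
  intro S N ε hε hS
  rcases S.eq_empty_or_nonempty with rfl | hne
  · refine ⟨Finsupp.single N 1, fun i => ?_, fun i hi => ?_, by simp, by simp⟩
    · rw [Finsupp.single_apply]; split_ifs <;> norm_num
    · have := Finsupp.support_single_subset hi
      simp at this
      omega
  obtain ⟨A₀, hA₀, hmax⟩ := S.exists_max_image rank hne
  set M := max N ((S.sup id).sup id + 1) with hM
  have hfar : ∀ A ∈ S, ∀ i, M ≤ i → i ∉ A := by
    intro A hA i hi hiA
    have h1 : i ∈ S.sup id := Finset.mem_sup.2 ⟨A, hA, hiA⟩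
    have h2 : i ≤ (S.sup id).sup id := Finset.le_sup (f := id) h1
    omega
  have key : ∀ k : ℕ, ∃ x : ℕ →₀ ℝ, (∀ i, 0 ≤ x i) ∧ (∀ i ∈ x.support, M ≤ i) ∧
      x.degree = k ∧ ∀ A ∈ S, ∀ B, A ∪ B ∈ G → ∑ i ∈ B, x i ≤ 1 + k * (ε / 2) := by
    intro k
    induction k with
    | zero => exact ⟨0, by simp, by simp, by simp, by simp⟩
    | succ k ihk =>
      obtain ⟨s, hs0, hsM, hsk, hs⟩ := ihk
      obtain ⟨x, hx0, hxM, hx1, hx⟩ := ih (rank A₀) (hS A₀ hA₀)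
        (((S ×ˢ s.support).image fun p => insert p.2 p.1).filter (· ∈ G)) M (ε / 2)
        (by positivity) (by
          intro A' hA'
          simp only [Finset.mem_filter, Finset.mem_image, Finset.mem_product, Prod.exists] at hA'
          obtain ⟨⟨A, i, ⟨hA, hi⟩, rfl⟩, hG⟩ := hA'
          exact (IsWellFounded.rank_lt_of_rel (r := fun B A : Finset ℕ => A ⊂ B ∧ B ∈ G)
            ⟨Finset.ssubset_insert (hfar A hA i (hsM i hi)), hG⟩).trans_le (hmax A hA))
      refine ⟨s + x, fun i => add_nonneg (hs0 i) (hx0 i), fun i hi => ?_, ?_, ?_⟩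
      · rcases Finset.mem_union.1 (Finsupp.support_add hi) with h | h
        exacts [hsM i h, hxM i h]
      · rw [map_add, hsk, hx1]; push_cast; ring
      · intro A hA B hB
        simp only [Finsupp.add_apply, Finset.sum_add_distrib]
        by_cases hi : ∃ i ∈ B, i ∈ s.support
        · obtain ⟨i, hiB, his⟩ := hi
          have hEq : insert i A ∪ B = A ∪ B := by
            rw [Finset.insert_union, Finset.insert_eq_self.2 (Finset.mem_union_right _ hiB)]
          have h1 := hx (insert i A) (by
            simp only [Finset.mem_filter, Finset.mem_image, Finset.mem_product, Prod.exists]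
            exact ⟨⟨A, i, ⟨hA, his⟩, rfl⟩,
              hdc _ _ Finset.subset_union_left (hEq ▸ hB)⟩) B (hEq ▸ hB)
          have h2 := hs A hA B hB
          push_cast
          linarith
        · have h1 : ∑ i ∈ B, s i = 0 := Finset.sum_eq_zero fun i hiB => by
            by_contra hne
            exact hi ⟨i, hiB, Finsupp.mem_support_iff.2 hne⟩
          have h2 : ∑ i ∈ B, x i ≤ x.degree := by
            rw [Finsupp.degree_apply]
            rw [← Finset.sum_filter_add_sum_filter_not B (· ∈ x.support)]
            rw [Finset.sum_eq_zero (s := B.filter (· ∉ x.support)) (by simp), add_zero]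
            exact Finset.sum_le_sum_of_subset_of_nonneg
              (fun i hi => (Finset.mem_filter.1 hi).2) fun i _ _ => hx0 i
          have h3 : 0 ≤ ((k + 1 : ℕ) : ℝ) * (ε / 2) := by positivity
          linarith
  obtain ⟨k, hk⟩ := exists_nat_gt (2 / ε)
  have hk0 : (0 : ℝ) < k := lt_trans (by positivity) hk
  obtain ⟨x, hx0, hxM, hxk, hx⟩ := key k
  refine ⟨(k : ℝ)⁻¹ • x, fun i => ?_, fun i hi => ?_, ?_, fun A hA B hB => ?_⟩
  · exact mul_nonneg (by positivity) (hx0 i)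
  · exact (le_max_left _ _).trans (hxM i (Finsupp.support_smul hi))
  · rw [Finsupp.degree_apply, Finsupp.support_smul_eq (inv_ne_zero hk0.ne')]
    simp only [Finsupp.smul_apply, smul_eq_mul, ← Finset.mul_sum]
    rw [← Finsupp.degree_apply, hxk, inv_mul_cancel₀ hk0.ne']
  · simp only [Finsupp.smul_apply, smul_eq_mul, ← Finset.mul_sum]
    rw [inv_mul_le_iff₀ hk0]
    have := hx A hA B hB
    rw [div_lt_iff₀ hε] at hk
    linarith

/-- Theorem 4.3: a downward-closed, convergence-enforcing family of finite subsets of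
`ℕ` must contain an infinite strictly ascending chain. -/
theorem exists_ascending_chain_of_convergenceEnforcing
    (F : Set (Set ℕ)) (hfin : ∀ A, ∀ _ : A ∈ F, A.Finite)
    (hdc : ∀ A B : Set ℕ, A ⊆ B → B ∈ F → A ∈ F)
    (hce : ∀ a : ℕ → ℝ, (∀ i, 0 ≤ a i) →
      (∀ A, ∀ hA : A ∈ F, ∑ i ∈ (hfin A hA).toFinset, a i ≤ 1) → Summable a) :
    ∃ A : ℕ → Set ℕ, (∀ i, A i ∈ F) ∧ ∀ i, A i ⊂ A (i + 1) := by
  by_contra hno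
  have hwf : WellFounded fun B A : Finset ℕ => A ⊂ B ∧ B ∈ {B : Finset ℕ | (B : Set ℕ) ∈ F} := by
    rw [wellFounded_iff_isEmpty_descending_chain]
    refine ⟨fun ⟨f, hf⟩ => hno ⟨fun n => f (n + 1), fun n => (hf n).2, fun n => ?_⟩⟩
    exact Finset.coe_ssubset.2 (hf (n + 1)).1
  have hex := fun n : ℕ => exists_small_probability_of_wellFounded
    {B : Finset ℕ | (B : Set ℕ) ∈ F}
    (fun A B hAB hB => hdc A B (Finset.coe_subset.2 hAB) hB) hwf {∅} n
    (ε := (1 / 2 : ℝ) ^ n / 2) (by positivity)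
  choose x hx0 hxn hx1 hx using hex
  have hext : ∀ i m, i < m →
      ∑ n ∈ Finset.range (i + 1), x n i = ∑ n ∈ Finset.range m, x n i := by
    intro i m him
    refine Finset.sum_subset (Finset.range_mono him) fun n _ hn => ?_
    by_contra hne
    have := hxn n i (Finsupp.mem_support_iff.2 hne)
    simp at hn
    omega
  have hnonneg : ∀ i, 0 ≤ ∑ n ∈ Finset.range (i + 1), x n i := fun i =>
    Finset.sum_nonneg fun n _ => hx0 n i
  have hsum := hce (fun i => ∑ n ∈ Finset.range (i + 1), x n i) hnonneg (by
    intro A hA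
    set B := (hfin A hA).toFinset with hB
    rw [Finset.sum_congr rfl fun i hi =>
      hext i (B.sup id + 1) (Nat.lt_succ_of_le (Finset.le_sup (f := id) hi)), Finset.sum_comm]
    refine (Finset.sum_le_sum fun n _ => hx n ∅ (by simp) B (by simpa [hB] using hA)).trans ?_
    rw [← Finset.sum_div]
    have := sum_geometric_two_le (B.sup id + 1)
    linarith)
  obtain ⟨m, hm⟩ := exists_nat_gt (∑' i, ∑ n ∈ Finset.range (i + 1), x n i)
  set L := max m (((Finset.range m).sup fun n => (x n).support).sup id + 1) with hL
  have h1 := hsum.sum_le_tsum (Finset.range L) fun i _ => hnonneg i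
  rw [Finset.sum_congr rfl fun i hi => hext i L (Finset.mem_range.1 hi), Finset.sum_comm] at h1
  have h2 : ∑ n ∈ Finset.range m, (x n).degree ≤
      ∑ n ∈ Finset.range L, ∑ i ∈ Finset.range L, x n i := by
    refine (Finset.sum_le_sum fun n hn => ?_).trans (Finset.sum_le_sum_of_subset_of_nonneg
      (Finset.range_mono (le_max_left _ _)) fun n _ _ => Finset.sum_nonneg fun i _ => hx0 n i)
    rw [Finsupp.degree_apply]
    refine Finset.sum_le_sum_of_subset_of_nonneg (fun i hi => ?_) fun i _ _ => hx0 n i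
    have h3 : i ∈ (Finset.range m).sup fun n => (x n).support := Finset.mem_sup.2 ⟨n, hn, hi⟩
    have h4 := Finset.le_sup (f := id) h3
    simp only [id] at h4
    rw [Finset.mem_range]
    omega
  simp only [hx1, Finset.sum_const, Finset.card_range, nsmul_eq_mul, mul_one] at h2
  linarith
end
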